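/- Under the stated Markovian switching network model, algorithm, and step-size assumptions, all agents almost surely converge to a common optimal solution: with probability 1 there exists a point x* ∈ X* = argmin_{x∈ℝⁿ} f(x) such that lim_{k→∞} x_i(k) = x* for every agent i ∈ {1,…,N}. -/

import Mathlib

open MeasureTheory Matrix Filter RealInnerProductSpace

/-- The subdifferential of `f : ℝⁿ → ℝ` at `z`:  `g ∈ ∂f(z)` iff
`f w ≥ f z + ⟪g, w − z⟫` for all `w`. -/
def subdiff {n : ℕ} (f : EuclideanSpace ℝ (Fin n) → ℝ) (z : EuclideanSpace ℝ (Fin n)) :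
    Set (EuclideanSpace ℝ (Fin n)) :=
  {g | ∀ w, f z + ⟪g, w - z⟫ ≤ f w}

section Disagreement

variable {ι κ E : Type*} [Fintype ι] [Fintype κ] [NormedAddCommGroup E]

/-- The quadratic disagreement `½ ∑ A i j ‖x i - x j‖²` of a configuration along a weighted graph. -/
noncomputable def disagreement (A : Matrix ι ι ℝ) (x : ι → E) : ℝ :=
  (1 / 2) * ∑ i, ∑ j, A i j * ‖x i - x j‖ ^ 2

theorem disagreement_nonneg {A : Matrix ι ι ℝ} (hA : ∀ i j, 0 ≤ A i j) (x : ι → E) :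
    0 ≤ disagreement A x :=
  mul_nonneg (by norm_num) <| Finset.sum_nonneg fun i _ => Finset.sum_nonneg fun j _ =>
    mul_nonneg (hA i j) (sq_nonneg _)

theorem sum_sum_mul_add_of_doublyStochastic {A : Matrix ι ι ℝ} (hrow : ∀ i, ∑ j, A i j = 1)
    (hcol : ∀ j, ∑ i, A i j = 1) (u v : ι → ℝ) :
    ∑ i, ∑ j, A i j * (u i + v j) = ∑ i, u i + ∑ i, v i := by
  simp only [mul_add, Finset.sum_add_distrib]
  congr 1
  · simp only [← Finset.sum_mul, hrow, one_mul]
  · rw [Finset.sum_comm]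
    simp only [← Finset.sum_mul, hcol, one_mul]

theorem disagreement_le {A : Matrix ι ι ℝ} (hA : ∀ i j, 0 ≤ A i j) (hrow : ∀ i, ∑ j, A i j = 1)
    (hcol : ∀ j, ∑ i, A i j = 1) (x : ι → E) :
    disagreement A x ≤ 2 * ∑ i, ‖x i‖ ^ 2 := by
  have h := sum_sum_mul_add_of_doublyStochastic hrow hcol
    (fun i => 2 * ‖x i‖ ^ 2) (fun i => 2 * ‖x i‖ ^ 2)
  have h2 : ∑ i, ∑ j, A i j * ‖x i - x j‖ ^ 2 ≤
      ∑ i, ∑ j, A i j * (2 * ‖x i‖ ^ 2 + 2 * ‖x j‖ ^ 2) := by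
    refine Finset.sum_le_sum fun i _ => Finset.sum_le_sum fun j _ =>
      mul_le_mul_of_nonneg_left ?_ (hA i j)
    have := norm_sub_le (x i) (x j)
    nlinarith [norm_nonneg (x i - x j), sq_nonneg (‖x i‖ - ‖x j‖)]
  simp only [← Finset.mul_sum] at h
  unfold disagreement
  linarith

theorem norm_add_sq_le_of_pos {τ : ℝ} (hτ : 0 < τ) (x y : E) :
    ‖x + y‖ ^ 2 ≤ (1 + τ) * ‖x‖ ^ 2 + (1 + 1 / τ) * ‖y‖ ^ 2 := by
  have h : ‖x + y‖ ^ 2 ≤ (‖x‖ + ‖y‖) ^ 2 := by gcongr; exact norm_add_le _ _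
  have h2 : 0 ≤ (τ * ‖x‖ - ‖y‖) ^ 2 / τ := by positivity
  have h3 : (τ * ‖x‖ - ‖y‖) ^ 2 / τ = τ * ‖x‖ ^ 2 - 2 * ‖x‖ * ‖y‖ + 1 / τ * ‖y‖ ^ 2 := by
    field_simp
    ring
  linarith

theorem sum_norm_add_sq_le_of_pos {τ : ℝ} (hτ : 0 < τ) (x y : ι → E) :
    ∑ i, ‖x i + y i‖ ^ 2 ≤ (1 + τ) * ∑ i, ‖x i‖ ^ 2 + (1 + 1 / τ) * ∑ i, ‖y i‖ ^ 2 := by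
  rw [Finset.mul_sum, Finset.mul_sum, ← Finset.sum_add_distrib]
  exact Finset.sum_le_sum fun i _ => norm_add_sq_le_of_pos hτ _ _

theorem disagreement_add_le {A : Matrix ι ι ℝ} (hA : ∀ i j, 0 ≤ A i j) {τ : ℝ} (hτ : 0 < τ)
    (x y : ι → E) :
    disagreement A (fun i => x i + y i) ≤
      (1 + τ) * disagreement A x + (1 + 1 / τ) * disagreement A y := by
  have h : ∑ i, ∑ j, A i j * ‖(x i + y i) - (x j + y j)‖ ^ 2 ≤
      ∑ i, ∑ j, ((1 + τ) * (A i j * ‖x i - x j‖ ^ 2) +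
        (1 + 1 / τ) * (A i j * ‖y i - y j‖ ^ 2)) := by
    refine Finset.sum_le_sum fun i _ => Finset.sum_le_sum fun j _ => ?_
    have := mul_le_mul_of_nonneg_left (norm_add_sq_le_of_pos hτ (x i - x j) (y i - y j)) (hA i j)
    rw [add_sub_add_comm]
    linarith
  simp only [Finset.sum_add_distrib, ← Finset.mul_sum] at h
  unfold disagreement
  linarith

variable [InnerProductSpace ℝ E]

/-- The consensus drift `∑ j, A i j • (x j - x i)` of a configuration. -/
noncomputable def consensusDrift (A : Matrix ι ι ℝ) (x : ι → E) (i : ι) : E :=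
  ∑ j, A i j • (x j - x i)

theorem sum_inner_consensusDrift {A : Matrix ι ι ℝ} (hrow : ∀ i, ∑ j, A i j = 1)
    (hcol : ∀ j, ∑ i, A i j = 1) (x : ι → E) :
    ∑ i, ⟪x i, consensusDrift A x i⟫ = -disagreement A x := by
  have h := sum_sum_mul_add_of_doublyStochastic hrow hcol
    (fun i => -‖x i‖ ^ 2) (fun i => ‖x i‖ ^ 2)
  have key : ∀ i j, ⟪x i, A i j • (x j - x i)⟫ =
      (1 / 2) * (A i j * (-‖x i‖ ^ 2 + ‖x j‖ ^ 2)) - (1 / 2) * (A i j * ‖x i - x j‖ ^ 2) := by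
    intro i j
    rw [inner_smul_right, inner_sub_right, real_inner_self_eq_norm_sq, norm_sub_sq_real]
    ring
  simp only [consensusDrift, inner_sum, key, Finset.sum_sub_distrib, ← Finset.mul_sum, h,
    disagreement]
  simp

theorem sum_norm_sq_consensusDrift_le {A : Matrix ι ι ℝ} (hA : ∀ i j, 0 ≤ A i j)
    (hrow : ∀ i, ∑ j, A i j = 1) (x : ι → E) :
    ∑ i, ‖consensusDrift A x i‖ ^ 2 ≤ 2 * disagreement A x := by
  have h : ∀ i, ‖consensusDrift A x i‖ ^ 2 ≤ ∑ j, A i j * ‖x i - x j‖ ^ 2 := by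
    intro i
    have h1 : ‖consensusDrift A x i‖ ≤ ∑ j, A i j * ‖x i - x j‖ := by
      refine (norm_sum_le _ _).trans (Finset.sum_le_sum fun j _ => ?_)
      rw [norm_smul, Real.norm_of_nonneg (hA i j), norm_sub_rev]
    calc _ ≤ (∑ j, A i j * ‖x i - x j‖) ^ 2 := by gcongr
      _ ≤ _ := Real.pow_arith_mean_le_arith_mean_pow _ _ _ (fun j _ => hA i j) (hrow i)
        (fun j _ => norm_nonneg _) 2
  unfold disagreement
  linarith [Finset.sum_le_sum fun i (_ : i ∈ Finset.univ) => h i]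

theorem sum_norm_sq_add_consensusDrift_le {A : Matrix ι ι ℝ} (hA : ∀ i j, 0 ≤ A i j)
    (hrow : ∀ i, ∑ j, A i j = 1) (hcol : ∀ j, ∑ i, A i j = 1) (x : ι → E) {α : ℝ}
    (hα : 0 ≤ α) (hα2 : α ≤ 1 / 2) :
    ∑ i, ‖x i + α • consensusDrift A x i‖ ^ 2 ≤ ∑ i, ‖x i‖ ^ 2 - α * disagreement A x := by
  have h1 := sum_inner_consensusDrift hrow hcol x
  have h2 := sum_norm_sq_consensusDrift_le hA hrow x
  have h3 := disagreement_nonneg hA x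
  have h4 : ∑ i, ‖x i + α • consensusDrift A x i‖ ^ 2 =
      ∑ i, ‖x i‖ ^ 2 + 2 * α * ∑ i, ⟪x i, consensusDrift A x i⟫ +
        α ^ 2 * ∑ i, ‖consensusDrift A x i‖ ^ 2 := by
    simp only [Finset.mul_sum, ← Finset.sum_add_distrib]
    refine Finset.sum_congr rfl fun i _ => ?_
    rw [norm_add_sq_real, inner_smul_right, norm_smul, mul_pow, Real.norm_eq_abs, sq_abs]
    ring
  rw [h4, h1]
  have h5 := mul_le_mul_of_nonneg_left h2 (sq_nonneg α)
  have h6 : 0 ≤ α * (1 / 2 - α) * disagreement A x :=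
    mul_nonneg (mul_nonneg hα (by linarith)) h3
  nlinarith

/-- If the union graph is strongly connected, the total disagreement controls every configuration
with zero mean. -/
theorem exists_sum_norm_sq_le_sum_disagreement {A : κ → Matrix ι ι ℝ}
    (hA : ∀ l i j, 0 ≤ A l i j)
    (hconn : ∀ i j : ι, Relation.ReflTransGen (fun u v : ι => ∃ l, 0 < A l v u) i j) :
    ∃ C : ℝ, 0 < C ∧ ∀ x : ι → E, ∑ i, x i = 0 →
      ∑ i, ‖x i‖ ^ 2 ≤ C * ∑ l, disagreement (A l) x := by
  have hS : ∀ x : ι → E, 0 ≤ ∑ l, disagreement (A l) x := fun x =>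
    Finset.sum_nonneg fun l _ => disagreement_nonneg (hA l) x
  have hpair : ∀ i j : ι, ∃ C : ℝ, 0 ≤ C ∧ ∀ x : ι → E,
      ‖x i - x j‖ ^ 2 ≤ C * ∑ l, disagreement (A l) x := by
    intro i j
    induction hconn i j with
    | refl => exact ⟨0, le_rfl, fun x => by simp⟩
    | @tail u v _ huv ih =>
      obtain ⟨C, hC, hC'⟩ := ih
      obtain ⟨l, hl⟩ := huv
      refine ⟨2 * C + 4 / A l v u, by positivity, fun x => ?_⟩
      have h1 : A l v u * ‖x v - x u‖ ^ 2 ≤ 2 * disagreement (A l) x := by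
        have ha : A l v u * ‖x v - x u‖ ^ 2 ≤ ∑ j, A l v j * ‖x v - x j‖ ^ 2 :=
          Finset.single_le_sum (f := fun j => A l v j * ‖x v - x j‖ ^ 2)
            (fun j _ => mul_nonneg (hA l v j) (sq_nonneg _)) (Finset.mem_univ u)
        have hb : ∑ j, A l v j * ‖x v - x j‖ ^ 2 ≤ ∑ i, ∑ j, A l i j * ‖x i - x j‖ ^ 2 :=
          Finset.single_le_sum (f := fun i => ∑ j, A l i j * ‖x i - x j‖ ^ 2)
            (fun i _ => Finset.sum_nonneg fun j _ => mul_nonneg (hA l i j) (sq_nonneg _))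
            (Finset.mem_univ v)
        unfold disagreement
        linarith
      have h2 : disagreement (A l) x ≤ ∑ l, disagreement (A l) x :=
        Finset.single_le_sum (f := fun l => disagreement (A l) x)
          (fun l _ => disagreement_nonneg (hA l) x) (Finset.mem_univ l)
      have h3 : ‖x v - x u‖ ^ 2 ≤ 2 / A l v u * ∑ l, disagreement (A l) x := by
        rw [div_mul_eq_mul_div, le_div_iff₀ hl]
        linarith
      have h4 : ‖x i - x v‖ ^ 2 ≤ 2 * ‖x i - x u‖ ^ 2 + 2 * ‖x v - x u‖ ^ 2 := by
        have := norm_add_sq_le_of_pos one_pos (x i - x u) (x u - x v)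
        rw [sub_add_sub_cancel, norm_sub_rev (x u)] at this
        linarith
      have h5 : (2 * C + 4 / A l v u) * ∑ l, disagreement (A l) x =
        2 * (C * ∑ l, disagreement (A l) x) + 2 * (2 / A l v u * ∑ l, disagreement (A l) x) := by
        ring
      linarith [hC' x]
  choose C hC hC' using hpair
  refine ⟨∑ i, ∑ j, C i j + 1, ?_, fun x hx => ?_⟩
  · have : 0 ≤ ∑ i, ∑ j, C i j :=
      Finset.sum_nonneg fun i _ => Finset.sum_nonneg fun j _ => hC i j
    linarith
  · have h1 : ∀ i, ‖x i‖ ^ 2 ≤ ∑ j, ‖x i - x j‖ ^ 2 := by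
      intro i
      have h2 : ∑ j, ‖x i - x j‖ ^ 2 =
          ∑ _j : ι, ‖x i‖ ^ 2 - 2 * ⟪x i, ∑ j, x j⟫ + ∑ j, ‖x j‖ ^ 2 := by
        rw [inner_sum, Finset.mul_sum, ← Finset.sum_sub_distrib, ← Finset.sum_add_distrib]
        exact Finset.sum_congr rfl fun j _ => norm_sub_sq_real _ _
      have h3 : ‖x i‖ ^ 2 ≤ ∑ j, ‖x j‖ ^ 2 :=
        Finset.single_le_sum (f := fun j => ‖x j‖ ^ 2) (fun j _ => sq_nonneg _) (Finset.mem_univ i)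
      have h4 : 0 ≤ ∑ _j : ι, ‖x i‖ ^ 2 := Finset.sum_nonneg fun j _ => sq_nonneg _
      rw [h2, hx, inner_zero_right]
      linarith
    calc ∑ i, ‖x i‖ ^ 2 ≤ ∑ i, ∑ j, ‖x i - x j‖ ^ 2 := Finset.sum_le_sum fun i _ => h1 i
      _ ≤ ∑ i, ∑ j, C i j * ∑ l, disagreement (A l) x :=
        Finset.sum_le_sum fun i _ => Finset.sum_le_sum fun j _ => hC' i j x
      _ = (∑ i, ∑ j, C i j) * ∑ l, disagreement (A l) x := by simp only [Finset.sum_mul]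
      _ ≤ _ := by
        gcongr
        · exact hS x
        · linarith

end Disagreement

section Foster

variable {κ : Type*} [Fintype κ] [DecidableEq κ]

/-- Foster–Lyapunov functions for the return to each state of an irreducible finite chain. -/
theorem exists_foster_function {P : Matrix κ κ ℝ} (hP : ∀ i j, 0 ≤ P i j)
    (hrow : ∀ i, ∑ j, P i j = 1) (hirr : ∀ i j, ∃ q : ℕ, 1 ≤ q ∧ 0 < (P ^ q) i j) :
    ∃ (w : κ → κ → ℝ) (K : ℝ), 0 ≤ K ∧ (∀ j s, 0 ≤ w j s) ∧
      ∀ j s, ∑ t, P s t * w j t ≤ w j s - 1 + if s = j then K else 0 := by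
  have key : ∀ j : κ, ∃ (w : κ → ℝ) (K : ℝ), 0 ≤ K ∧ (∀ s, 0 ≤ w s) ∧
      ∀ s, ∑ t, P s t * w t ≤ w s - 1 + if s = j then K else 0 := by
    intro j
    choose q hq1 hq using fun s => hirr s j
    set H := ∑ s, q s with hH
    set S : Matrix κ κ ℝ := ∑ r ∈ Finset.range H, ∑ i ∈ Finset.range (r + 1), P ^ i with hS
    have hPS : P * S = S + ∑ r ∈ Finset.range H, (P ^ (r + 1) - 1) := by
      rw [hS, Finset.mul_sum, ← Finset.sum_add_distrib]
      refine Finset.sum_congr rfl fun r _ => ?_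
      rw [Finset.mul_sum]
      have := Finset.sum_range_sub (fun i => P ^ i) (r + 1)
      rw [Finset.sum_sub_distrib, sub_eq_iff_eq_add] at this
      simp only [← pow_succ', this, pow_zero]
      abel
    have hS0 : ∀ s, 0 ≤ S s j := by
      intro s
      simp only [hS, Matrix.sum_apply]
      exact Finset.sum_nonneg fun r _ => Finset.sum_nonneg fun i _ => pow_apply_nonneg hP _ _ _
    have hpos : ∀ s, 0 < ∑ r ∈ Finset.range H, (P ^ (r + 1)) s j := by
      intro s
      refine Finset.sum_pos' (fun r _ => pow_apply_nonneg hP _ _ _) ⟨q s - 1, ?_, ?_⟩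
      · have : q s ≤ H := Finset.single_le_sum (f := q) (fun _ _ => Nat.zero_le _)
          (Finset.mem_univ s)
        have := hq1 s
        simp only [Finset.mem_range]
        omega
      · rw [Nat.sub_add_cancel (hq1 s)]
        exact hq s
    obtain ⟨s₀, -, hs₀⟩ := Finset.exists_min_image Finset.univ
      (fun s => ∑ r ∈ Finset.range H, (P ^ (r + 1)) s j) ⟨j, Finset.mem_univ j⟩
    set ε := ∑ r ∈ Finset.range H, (P ^ (r + 1)) s₀ j with hε
    have hε0 : 0 < ε := hpos s₀
    refine ⟨fun s => (∑ t, S t j - S s j) / ε, H / ε, by positivity, fun s => ?_, fun s => ?_⟩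
    · refine div_nonneg (sub_nonneg.2 ?_) hε0.le
      exact Finset.single_le_sum (f := fun t => S t j) (fun t _ => hS0 t) (Finset.mem_univ s)
    · have h1 : ∑ t, P s t * S t j = S s j + (∑ r ∈ Finset.range H, (P ^ (r + 1)) s j) -
          if s = j then (H : ℝ) else 0 := by
        have := congrFun (congrFun hPS s) j
        rw [mul_apply] at this
        rw [this]
        simp only [Matrix.add_apply, Matrix.sum_apply, Matrix.sub_apply, one_apply]
        simp only [Finset.sum_sub_distrib, Finset.sum_const, Finset.card_range, nsmul_eq_mul]
        split_ifs <;> ring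
      have h2 : ∑ t, P s t * ((∑ t, S t j - S t j) / ε) =
          (∑ t, S t j - ∑ t, P s t * S t j) / ε := by
        simp only [mul_div_assoc', mul_sub, ← Finset.sum_div, Finset.sum_sub_distrib,
          ← Finset.sum_mul, hrow, one_mul]
      have h3 := hs₀ s (Finset.mem_univ s)
      rw [h2, h1, div_le_iff₀ hε0]
      split_ifs <;> field_simp <;> linarith
  choose w K hK hw h using key
  refine ⟨w, ∑ j, K j, Finset.sum_nonneg fun j _ => hK j, hw, fun j s => (h j s).trans ?_⟩
  have : K j ≤ ∑ j, K j := Finset.single_le_sum (fun j _ => hK j) (Finset.mem_univ j)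
  split_ifs <;> linarith

end Foster

section Step

variable {ι κ E : Type*} [Fintype ι] [Fintype κ] [NormedAddCommGroup E] [InnerProductSpace ℝ E]

theorem sum_norm_smul_sq_le {η : ι → E} {c : ℝ} (hη : ∀ i, ‖η i‖ ≤ c) (β : ℝ) :
    ∑ i, ‖-(β • η i)‖ ^ 2 ≤ Fintype.card ι * (c ^ 2 * β ^ 2) := by
  have h : ∀ i, ‖-(β • η i)‖ ^ 2 ≤ c ^ 2 * β ^ 2 := by
    intro i
    rw [norm_neg, norm_smul, mul_pow, Real.norm_eq_abs, sq_abs, mul_comm]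
    gcongr
    exact hη i
  calc _ ≤ ∑ _i : ι, c ^ 2 * β ^ 2 := Finset.sum_le_sum fun i _ => h i
    _ = _ := by simp

/-- One step of consensus with a bounded perturbation: decrease of the squared deviation. -/
theorem sum_norm_sq_step_le {A : Matrix ι ι ℝ} (hA : ∀ i j, 0 ≤ A i j)
    (hrow : ∀ i, ∑ j, A i j = 1) (hcol : ∀ j, ∑ i, A i j = 1) {e e' η : ι → E} {α β c τ : ℝ}
    (hα : 0 < α) (hα2 : α ≤ 1 / 2) (hτ : 0 < τ) (hη : ∀ i, ‖η i‖ ≤ c)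
    (he : ∀ i, e' i = e i + α • consensusDrift A e i - β • η i) :
    ∑ i, ‖e' i‖ ^ 2 ≤ (1 + τ * α) * ∑ i, ‖e i‖ ^ 2 - α * disagreement A e +
      (1 + 1 / τ) * (Fintype.card ι * c ^ 2) * (β ^ 2 / α) := by
  have h1 := sum_norm_add_sq_le_of_pos (mul_pos hτ hα)
    (fun i => e i + α • consensusDrift A e i) (fun i => -(β • η i))
  have h2 := sum_norm_sq_add_consensusDrift_le hA hrow hcol e hα.le hα2
  have h3 := sum_norm_smul_sq_le hη β
  have h4 := disagreement_nonneg hA e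
  have h5 : 1 + 1 / (τ * α) ≤ (1 + 1 / τ) / α := by
    rw [← sub_nonneg]
    have : (1 + 1 / τ) / α - (1 + 1 / (τ * α)) = (1 - α) / α := by
      field_simp
      ring
    rw [this]
    exact div_nonneg (by linarith) hα.le
  have h6 : (1 + 1 / (τ * α)) * ∑ i, ‖-(β • η i)‖ ^ 2 ≤
      (1 + 1 / τ) / α * (Fintype.card ι * (c ^ 2 * β ^ 2)) :=
    mul_le_mul h5 h3 (Finset.sum_nonneg fun i _ => sq_nonneg _) (by positivity)
  have h7 : (1 + τ * α) * ∑ i, ‖e i + α • consensusDrift A e i‖ ^ 2 ≤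
      (1 + τ * α) * (∑ i, ‖e i‖ ^ 2 - α * disagreement A e) := by gcongr
  have h8 : 0 ≤ τ * α * (α * disagreement A e) := by positivity
  simp only [he, sub_eq_add_neg]
  have h9 : (1 + 1 / τ) / α * (Fintype.card ι * (c ^ 2 * β ^ 2)) =
    (1 + 1 / τ) * (Fintype.card ι * c ^ 2) * (β ^ 2 / α) := by ring
  linarith

/-- One step of consensus with a bounded perturbation: growth of another disagreement form. -/
theorem disagreement_step_le {A B : Matrix ι ι ℝ} (hA : ∀ i j, 0 ≤ A i j)
    (hrow : ∀ i, ∑ j, A i j = 1) (hcol : ∀ j, ∑ i, A i j = 1) (hB : ∀ i j, 0 ≤ B i j)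
    (hBrow : ∀ i, ∑ j, B i j = 1) (hBcol : ∀ j, ∑ i, B i j = 1)
    {e e' η : ι → E} {α β c τ : ℝ} (hτ : 0 < τ) (hη : ∀ i, ‖η i‖ ≤ c)
    (he : ∀ i, e' i = e i + α • consensusDrift A e i - β • η i) :
    disagreement B e' ≤ disagreement B e + (2 * τ + (1 + 1 / τ) * 16 * α ^ 2) * ∑ i, ‖e i‖ ^ 2 +
      (1 + 1 / τ) * 4 * (Fintype.card ι * c ^ 2) * β ^ 2 := by
  set y : ι → E := fun i => α • consensusDrift A e i + -(β • η i) with hy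
  have he' : e' = fun i => e i + y i := by
    funext i
    rw [he i, hy, sub_eq_add_neg, add_assoc]
  have h1 := disagreement_add_le hB hτ e y
  have h2 := disagreement_le hB hBrow hBcol e
  have h3 := disagreement_le hB hBrow hBcol y
  have h4 := sum_norm_add_sq_le_of_pos one_pos
    (fun i => α • consensusDrift A e i) (fun i => -(β • η i))
  have h5 := sum_norm_smul_sq_le hη β
  have h6 : ∑ i, ‖α • consensusDrift A e i‖ ^ 2 = α ^ 2 * ∑ i, ‖consensusDrift A e i‖ ^ 2 := by
    rw [Finset.mul_sum]
    exact Finset.sum_congr rfl fun i _ => by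
      rw [norm_smul, mul_pow, Real.norm_eq_abs, sq_abs]
  have h7 : ∑ i, ‖consensusDrift A e i‖ ^ 2 ≤ 4 * ∑ i, ‖e i‖ ^ 2 := by
    linarith [sum_norm_sq_consensusDrift_le hA hrow e, disagreement_le hA hrow hcol e]
  have h8 := mul_le_mul_of_nonneg_left h7 (sq_nonneg α)
  have h9 : disagreement B y ≤
      16 * α ^ 2 * ∑ i, ‖e i‖ ^ 2 + 4 * (Fintype.card ι * (c ^ 2 * β ^ 2)) := by
    rw [h6] at h4
    linarith
  have h10 : (1 + 1 / τ) * disagreement B y ≤ (1 + 1 / τ) *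
      (16 * α ^ 2 * ∑ i, ‖e i‖ ^ 2 + 4 * (Fintype.card ι * (c ^ 2 * β ^ 2))) := by gcongr
  have h11 := mul_le_mul_of_nonneg_left h2 hτ.le
  rw [he']
  linarith

/-- The Foster functions correct the squared deviation into a Lyapunov function which decreases
on average at every step, up to the difference between a Foster function at the new state and its
conditional mean. -/
theorem exists_lyapunov_step {A : κ → Matrix ι ι ℝ} (hA : ∀ l i j, 0 ≤ A l i j)
    (hrow : ∀ l i, ∑ j, A l i j = 1) (hcol : ∀ l j, ∑ i, A l i j = 1)
    [DecidableEq κ] {P : Matrix κ κ ℝ} {w : κ → κ → ℝ} {K : ℝ} (hK : 0 ≤ K)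
    (hw : ∀ j s, 0 ≤ w j s)
    (hP : ∀ j s, ∑ t, P s t * w j t ≤ w j s - 1 + if s = j then K else 0)
    {C : ℝ} (hC : 0 < C) (c : ℝ) :
    ∃ r a₀ B : ℝ, 0 < r ∧ 0 < a₀ ∧ 0 ≤ B ∧
      ∀ (e e' η : ι → E) (s t : κ) (α α' β : ℝ), 0 < α → α ≤ a₀ → α' ≤ α →
        (∀ i, ‖η i‖ ≤ c) →
        ∑ i, ‖e i‖ ^ 2 ≤ C * ∑ j, disagreement (A j) e →
        (∀ i, e' i = e i + α • consensusDrift (A s) e i - β • η i) →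
        K * ∑ i, ‖e' i‖ ^ 2 + α' * ∑ j, w j t * disagreement (A j) e' ≤
          (K * ∑ i, ‖e i‖ ^ 2 + α * ∑ j, w j s * disagreement (A j) e) +
          α * (∑ j, w j t * disagreement (A j) e -
            ∑ j, (∑ u, P s u * w j u) * disagreement (A j) e) -
          r * (α * ∑ i, ‖e i‖ ^ 2) + B * (β ^ 2 / α) := by
  set W := ∑ j, ∑ s, w j s with hW
  have hW0 : 0 ≤ W := Finset.sum_nonneg fun j _ => Finset.sum_nonneg fun s _ => hw j s
  set τ := 1 / (2 * C * (K + 3 * W + 1)) with hτ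
  have hτ0 : 0 < τ := by positivity
  set D := (1 + 1 / τ) * (Fintype.card ι * c ^ 2) with hD
  have hD0 : 0 ≤ D := by positivity
  refine ⟨1 / (2 * C), min (1 / 2) (τ / (16 * (1 + 1 / τ))), K * D + W * (4 * D), by positivity,
    by positivity, by positivity, ?_⟩
  intro e e' η s t α α' β hα hαa hα' hη hV he
  have hα2 : α ≤ 1 / 2 := hαa.trans (min_le_left _ _)
  have hα3 : (1 + 1 / τ) * 16 * α ^ 2 ≤ τ := by
    have h : α ≤ τ / (16 * (1 + 1 / τ)) := hαa.trans (min_le_right _ _)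
    rw [le_div_iff₀ (by positivity)] at h
    have h2 : (1 + 1 / τ) * 16 * α ^ 2 = α * (16 * (1 + 1 / τ)) * α := by ring
    rw [h2]
    nlinarith
  set V := ∑ i, ‖e i‖ ^ 2 with hVdef
  have hV0 : 0 ≤ V := Finset.sum_nonneg fun i _ => sq_nonneg _
  have h1 := sum_norm_sq_step_le (hA s) (hrow s) (hcol s) hα hα2 hτ0 hη he
  have h2 : ∀ j, disagreement (A j) e' ≤ disagreement (A j) e + (3 * τ * V + 4 * D * β ^ 2) := by
    intro j
    have := disagreement_step_le (hA s) (hrow s) (hcol s) (hA j) (hrow j) (hcol j) hτ0 hη he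
    have h3 := mul_le_mul_of_nonneg_right hα3 hV0
    have h4 : (1 + 1 / τ) * 4 * (Fintype.card ι * c ^ 2) * β ^ 2 = 4 * D * β ^ 2 := by
      rw [hD]; ring
    linarith
  have hQ0 : ∀ j, 0 ≤ disagreement (A j) e' := fun j => disagreement_nonneg (hA j) e'
  have hX0 : 0 ≤ 3 * τ * V + 4 * D * β ^ 2 := by positivity
  have h3 : ∑ j, w j t * disagreement (A j) e' ≤
      ∑ j, w j t * disagreement (A j) e + W * (3 * τ * V + 4 * D * β ^ 2) := by
    have hle : ∑ j, w j t ≤ W :=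
      Finset.sum_le_sum fun j _ => Finset.single_le_sum (fun s _ => hw j s) (Finset.mem_univ t)
    calc _ ≤ ∑ j, w j t * (disagreement (A j) e + (3 * τ * V + 4 * D * β ^ 2)) :=
          Finset.sum_le_sum fun j _ => mul_le_mul_of_nonneg_left (h2 j) (hw j t)
      _ = ∑ j, w j t * disagreement (A j) e + (∑ j, w j t) * (3 * τ * V + 4 * D * β ^ 2) := by
          simp only [mul_add, Finset.sum_add_distrib, Finset.sum_mul]
      _ ≤ _ := by gcongr
  have h4 : α' * ∑ j, w j t * disagreement (A j) e' ≤
      α * (∑ j, w j t * disagreement (A j) e + W * (3 * τ * V + 4 * D * β ^ 2)) := by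
    refine (mul_le_mul_of_nonneg_right hα' ?_).trans (mul_le_mul_of_nonneg_left h3 hα.le)
    exact Finset.sum_nonneg fun j _ => mul_nonneg (hw j t) (hQ0 j)
  have h5 : ∑ j, (∑ u, P s u * w j u) * disagreement (A j) e ≤
      ∑ j, w j s * disagreement (A j) e - ∑ j, disagreement (A j) e + K * disagreement (A s) e := by
    calc _ ≤ ∑ j, (w j s - 1 + if s = j then K else 0) * disagreement (A j) e :=
          Finset.sum_le_sum fun j _ =>
            mul_le_mul_of_nonneg_right (hP j s) (disagreement_nonneg (hA j) e)
      _ = _ := by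
          simp [add_mul, sub_mul, Finset.sum_add_distrib, Finset.sum_sub_distrib, ite_mul]
  have h6 : (K + 3 * W) * τ * V + 1 / (2 * C) * V ≤ ∑ j, disagreement (A j) e := by
    have ha : (K + 3 * W) * τ ≤ 1 / (2 * C) := by
      rw [hτ, mul_one_div, div_le_div_iff₀ (by positivity) (by positivity)]
      nlinarith
    have hb : V / C ≤ ∑ j, disagreement (A j) e := by
      rw [div_le_iff₀ hC]
      linarith
    have hc : 1 / (2 * C) * V + 1 / (2 * C) * V = V / C := by
      field_simp
      ring
    have hd := mul_le_mul_of_nonneg_right ha hV0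
    linarith
  have h7 : α * β ^ 2 ≤ β ^ 2 / α := by
    rw [le_div_iff₀ hα]
    have : α * α ≤ 1 := by nlinarith
    nlinarith [sq_nonneg β]
  have h8 := mul_le_mul_of_nonneg_left h1 hK
  have h9 := mul_le_mul_of_nonneg_left h5 hα.le
  have h10 := mul_le_mul_of_nonneg_left h6 hα.le
  have h11 := mul_le_mul_of_nonneg_left h7 (by positivity : 0 ≤ W * (4 * D))
  linarith

end Step

section Sequences

/-- Deterministic Robbins–Siegmund lemma. -/
theorem summable_and_tendsto_of_le_sub_add {u a b : ℕ → ℝ} {k₀ : ℕ} (hu : ∀ k, 0 ≤ u k)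
    (ha : ∀ k, 0 ≤ a k) (hb : ∀ k, 0 ≤ b k) (hbs : Summable b)
    (h : ∀ k, k₀ ≤ k → u (k + 1) ≤ u k - a k + b k) :
    Summable a ∧ ∃ c, Tendsto u atTop (nhds c) := by
  wlog hk : k₀ = 0 generalizing u a b k₀
  · obtain ⟨h1, c, h2⟩ := this (u := fun k => u (k + k₀)) (a := fun k => a (k + k₀))
      (b := fun k => b (k + k₀)) (k₀ := 0) (fun k => hu _) (fun k => ha _) (fun k => hb _)
      ((summable_nat_add_iff k₀).2 hbs)
      (fun k _ => by
        have := h (k + k₀) (Nat.le_add_left _ _)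
        rwa [add_right_comm] at this) rfl
    exact ⟨(summable_nat_add_iff k₀).1 h1, c, (tendsto_add_atTop_iff_nat k₀).1 h2⟩
  subst hk
  have hsum : ∀ k, u k + ∑ i ∈ Finset.range k, a i - ∑ i ∈ Finset.range k, b i ≤ u 0 := by
    intro k
    induction k with
    | zero => simp
    | succ k ih =>
      rw [Finset.sum_range_succ, Finset.sum_range_succ]
      linarith [h k (Nat.zero_le k)]
  have hbt : ∀ k, ∑ i ∈ Finset.range k, b i ≤ ∑' i, b i := fun k =>
    hbs.sum_le_tsum _ fun i _ => hb i
  have has : Summable a := summable_of_sum_range_le (c := u 0 + ∑' i, b i) ha fun k => by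
    linarith [hsum k, hbt k, hu k]
  refine ⟨has, ?_⟩
  have hanti : Antitone
      fun k => u k + ∑ i ∈ Finset.range k, a i - ∑ i ∈ Finset.range k, b i := by
    refine antitone_nat_of_succ_le fun k => ?_
    rw [Finset.sum_range_succ, Finset.sum_range_succ]
    linarith [h k (Nat.zero_le k)]
  have hbdd : BddBelow (Set.range
      fun k => u k + ∑ i ∈ Finset.range k, a i - ∑ i ∈ Finset.range k, b i) := by
    refine ⟨-∑' i, b i, ?_⟩
    rintro _ ⟨k, rfl⟩
    have : 0 ≤ ∑ i ∈ Finset.range k, a i := Finset.sum_nonneg fun i _ => ha i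
    dsimp only
    linarith [hbt k, hu k]
  have hlim := ((tendsto_atTop_ciInf hanti hbdd).sub has.hasSum.tendsto_sum_nat).add
    hbs.hasSum.tendsto_sum_nat
  refine ⟨_, hlim.congr fun k => ?_⟩
  ring

theorem frequently_lt_of_summable_mul {β u : ℕ → ℝ} (hβ : ∀ k, 0 ≤ β k) (hβs : ¬Summable β)
    (h : Summable fun k => β k * u k) {ε : ℝ} (hε : 0 < ε) :
    ∃ᶠ k in atTop, u k < ε := by
  intro hev
  refine hβs (Summable.of_norm_bounded_eventually_nat (h.mul_left (1 / ε)) ?_)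
  filter_upwards [hev] with k hk
  rw [Real.norm_of_nonneg (hβ k)]
  have := mul_le_mul_of_nonneg_left (not_lt.1 hk) (hβ k)
  rw [one_div, ← div_eq_inv_mul, le_div_iff₀ hε]
  exact this

theorem tendsto_zero_of_summable_mul {β u : ℕ → ℝ} (hβ : ∀ k, 0 ≤ β k) (hβs : ¬Summable β)
    (hu : ∀ k, 0 ≤ u k) (h : Summable fun k => β k * u k) {c : ℝ}
    (hc : Tendsto u atTop (nhds c)) : Tendsto u atTop (nhds 0) := by
  have hc0 : 0 ≤ c := ge_of_tendsto' hc hu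
  rcases hc0.eq_or_lt with rfl | hpos
  · exact hc
  · have h1 : ∀ᶠ k in atTop, c / 2 < u k := hc.eventually (lt_mem_nhds (by linarith))
    obtain ⟨k, hk1, hk2⟩ := ((frequently_lt_of_summable_mul hβ hβs h (half_pos hpos)).and_eventually
      h1).exists
    exact absurd hk1 hk2.not_gt

/-- Quasi-Fejér monotone sequences with vanishing optimality gap along a divergent series of
steps converge to a minimizer. -/
theorem exists_tendsto_minimizer {E : Type*} [NormedAddCommGroup E] [ProperSpace E]
    {F : E → ℝ} (hF : Continuous F) (hmin : ∃ y, ∀ z, F y ≤ F z) {z : ℕ → E} {β b : ℕ → ℝ}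
    (hβ : ∀ k, 0 ≤ β k) (hβs : ¬Summable β) (hb : ∀ k, 0 ≤ b k) (hbs : Summable b)
    {k₀ : ℕ}
    (hstep : ∀ y, (∀ v, F y ≤ F v) → ∀ k, k₀ ≤ k →
      ‖z (k + 1) - y‖ ^ 2 ≤ ‖z k - y‖ ^ 2 - β k * (F (z k) - F y) + b k) :
    ∃ y, (∀ v, F y ≤ F v) ∧ Tendsto z atTop (nhds y) := by
  have key : ∀ y, (∀ v, F y ≤ F v) → (Summable fun k => β k * (F (z k) - F y)) ∧
      ∃ c, Tendsto (fun k => ‖z k - y‖ ^ 2) atTop (nhds c) := fun y hy =>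
    summable_and_tendsto_of_le_sub_add (fun k => sq_nonneg _)
      (fun k => mul_nonneg (hβ k) (sub_nonneg.2 (hy _))) hb hbs (hstep y hy)
  obtain ⟨y, hy⟩ := hmin
  obtain ⟨hs, c, hc⟩ := key y hy
  obtain ⟨φ, hφ, hφ2⟩ := extraction_forall_of_frequently (fun n : ℕ =>
    frequently_lt_of_summable_mul hβ hβs hs (Nat.one_div_pos_of_nat (α := ℝ) (n := n)))
  obtain ⟨M, hM⟩ := hc.bddAbove_range
  have hball : ∀ k, z (φ k) ∈ Metric.closedBall y (M + 1) := by
    intro k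
    have h1 : ‖z (φ k) - y‖ ^ 2 ≤ M := hM ⟨φ k, rfl⟩
    rw [mem_closedBall_iff_norm]
    nlinarith [sq_nonneg (‖z (φ k) - y‖ - 1), norm_nonneg (z (φ k) - y)]
  obtain ⟨x, -, ψ, hψ, hx⟩ := tendsto_subseq_of_bounded Metric.isBounded_closedBall hball
  have hFx : F x ≤ F y := by
    have h1 : Tendsto (fun k => F (z (φ (ψ k))) - F y) atTop (nhds (F x - F y)) :=
      ((hF.tendsto x).comp hx).sub_const _
    have h2 : Tendsto (fun k : ℕ => 1 / ((ψ k : ℝ) + 1)) atTop (nhds 0) :=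
      tendsto_one_div_add_atTop_nhds_zero_nat.comp hψ.tendsto_atTop
    linarith [le_of_tendsto_of_tendsto' h1 h2 fun k => (hφ2 (ψ k)).le]
  have hxmin : ∀ v, F x ≤ F v := fun v => hFx.trans (hy v)
  refine ⟨x, hxmin, ?_⟩
  obtain ⟨-, c', hc'⟩ := key x hxmin
  have h0 : Tendsto (fun k => ‖z (φ (ψ k)) - x‖ ^ 2) atTop (nhds 0) := by
    have : Tendsto (fun k => ‖z (φ (ψ k)) - x‖) atTop (nhds 0) :=
      tendsto_iff_norm_sub_tendsto_zero.1 hx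
    simpa using this.pow 2
  have hc0 : c' = 0 :=
    tendsto_nhds_unique (hc'.comp (hφ.comp hψ).tendsto_atTop) h0
  rw [tendsto_iff_norm_sub_tendsto_zero]
  have := (hc0 ▸ hc').sqrt
  simpa using this

end Sequences

section Probability

variable {Ω κ : Type*} {m m0 : MeasurableSpace Ω} {μ : Measure Ω}

theorem ae_summable_of_summable_integral {f : ℕ → Ω → ℝ} (hf : ∀ k ω, 0 ≤ f k ω)
    (hfi : ∀ k, Integrable (f k) μ) (hs : Summable fun k => ∫ ω, f k ω ∂μ) :
    ∀ᵐ ω ∂μ, Summable fun k => f k ω := by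
  have hm : ∀ k, AEMeasurable (fun ω => ENNReal.ofReal (f k ω)) μ := fun k =>
    (hfi k).aemeasurable.ennreal_ofReal
  have h1 : ∫⁻ ω, ∑' k, ENNReal.ofReal (f k ω) ∂μ ≠ ⊤ := by
    rw [lintegral_tsum hm]
    simp only [← ofReal_integral_eq_lintegral_ofReal (hfi _) (ae_of_all _ (hf _))]
    exact hs.tsum_ofReal_ne_top
  filter_upwards [ae_lt_top' (AEMeasurable.tsum hm) h1] with ω hω
  simpa only [ENNReal.toReal_ofReal (hf _ ω)] using ENNReal.summable_toReal hω.ne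

variable [Fintype κ] [MeasurableSpace κ] [DiscreteMeasurableSpace κ]

theorem integrable_comp_mul (g : κ → ℝ) {θ : Ω → κ} (hθ : Measurable θ) {Y : Ω → ℝ}
    (hY : Integrable Y μ) : Integrable (fun ω => g (θ ω) * Y ω) μ := by
  refine hY.bdd_mul (c := ∑ s, |g s|)
    ((Measurable.of_discrete (f := g)).comp hθ).aestronglyMeasurable (ae_of_all _ fun ω => ?_)
  exact Finset.single_le_sum (f := fun s => |g s|) (fun s _ => abs_nonneg _) (Finset.mem_univ _)

/-- The Markov property tested against an integrable function of the past. -/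
theorem integral_comp_mul_of_markov [IsFiniteMeasure μ] (hm : m ≤ m0)
    {P : Matrix κ κ ℝ} {θ θ' : Ω → κ} (hθ : Measurable θ) (hθ' : Measurable θ')
    (hmarkov : ∀ j, μ[Set.indicator {ω | θ' ω = j} (fun _ => (1 : ℝ))|m] =ᵐ[μ]
      fun ω => P (θ ω) j)
    (g : κ → ℝ) {Y : Ω → ℝ} (hYm : Measurable[m] Y) (hY : Integrable Y μ) :
    ∫ ω, g (θ' ω) * Y ω ∂μ = ∫ ω, (∑ t, P (θ ω) t * g t) * Y ω ∂μ := by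
  classical
  have hind : ∀ t, Set.indicator {ω | θ' ω = t} (fun _ => (1 : ℝ)) =
      fun ω => if θ' ω = t then 1 else 0 := fun t => by
    funext ω
    simp [Set.indicator_apply]
  have h1 : ∀ t, ∫ ω, (if θ' ω = t then 1 else 0) * Y ω ∂μ = ∫ ω, P (θ ω) t * Y ω ∂μ := by
    intro t
    have hi : Integrable (fun ω => (if θ' ω = t then (1 : ℝ) else 0)) μ := by
      simpa using integrable_comp_mul (fun s => if s = t then (1 : ℝ) else 0) hθ'
        (integrable_const (1 : ℝ))
    have hiY : Integrable ((fun ω => (if θ' ω = t then (1 : ℝ) else 0)) * Y) μ :=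
      integrable_comp_mul (fun s => if s = t then (1 : ℝ) else 0) hθ' hY
    have hp := condExp_mul_of_stronglyMeasurable_right (m := m) hYm.stronglyMeasurable hiY hi
    have hmt := hmarkov t
    rw [hind] at hmt
    change ∫ ω, ((fun ω => (if θ' ω = t then (1 : ℝ) else 0)) * Y) ω ∂μ = _
    rw [← integral_condExp hm]
    refine integral_congr_ae ?_
    filter_upwards [hp, hmt] with ω h2 h3
    rw [h2, Pi.mul_apply, h3]
  have h2 : ∀ ω, g (θ' ω) * Y ω = ∑ t, g t * ((if θ' ω = t then 1 else 0) * Y ω) := by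
    intro ω
    simp
  have h3 : ∀ ω, (∑ t, P (θ ω) t * g t) * Y ω = ∑ t, g t * (P (θ ω) t * Y ω) := by
    intro ω
    rw [Finset.sum_mul]
    exact Finset.sum_congr rfl fun t _ => by ring
  simp only [h2, h3]
  rw [integral_finsetSum, integral_finsetSum]
  · simp only [integral_const_mul, h1]
  · exact fun t _ => (integrable_comp_mul (fun s => P s t) hθ hY).const_mul _
  · exact fun t _ => (integrable_comp_mul (fun s => if s = t then (1 : ℝ) else 0) hθ' hY).const_mul _

end Probability

section Consensus

variable {ι κ E : Type*} [Fintype ι] [NormedAddCommGroup E]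

theorem measurable_disagreement {Ω : Type*} {m : MeasurableSpace Ω} [MeasurableSpace E] [BorelSpace E]
    [SecondCountableTopology E] (A : Matrix ι ι ℝ) {e : Ω → ι → E}
    (he : ∀ i, Measurable fun ω => e ω i) : Measurable fun ω => disagreement A (e ω) := by
  unfold disagreement
  fun_prop

theorem measurable_sum_norm_sq {Ω : Type*} {m : MeasurableSpace Ω} [MeasurableSpace E] [BorelSpace E]
    {e : Ω → ι → E} (he : ∀ i, Measurable fun ω => e ω i) :
    Measurable fun ω => ∑ i, ‖e ω i‖ ^ 2 := by
  fun_prop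

variable [InnerProductSpace ℝ E] [Fintype κ] [DecidableEq κ] [MeasurableSpace κ] [DiscreteMeasurableSpace κ]
  [MeasurableSpace E] [BorelSpace E] [SecondCountableTopology E]

/-- Perturbed consensus over a Markovian switching network: the squared deviations are almost
surely summable against the consensus step sizes. -/
theorem ae_summable_sum_norm_sq {Ω : Type*} {m0 : MeasurableSpace Ω} {μ : Measure Ω}
    [IsProbabilityMeasure μ] {𝓕 : Filtration ℕ m0} {P : Matrix κ κ ℝ}
    (hP_nonneg : ∀ i j, 0 ≤ P i j) (hP_row : ∀ i, ∑ j, P i j = 1)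
    (hP_irr : ∀ i j, ∃ q : ℕ, 1 ≤ q ∧ 0 < (P ^ q) i j) {θ : ℕ → Ω → κ}
    (hθ : ∀ k, Measurable (θ k))
    (hmarkov : ∀ k j, μ[Set.indicator {ω | θ (k + 1) ω = j} (fun _ => (1 : ℝ))|𝓕 k] =ᵐ[μ]
      fun ω => P (θ k ω) j)
    {A : κ → Matrix ι ι ℝ} (hA : ∀ l i j, 0 ≤ A l i j) (hrow : ∀ l i, ∑ j, A l i j = 1)
    (hcol : ∀ l j, ∑ i, A l i j = 1)
    (hconn : ∀ i j : ι, Relation.ReflTransGen (fun u v : ι => ∃ l, 0 < A l v u) i j)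
    {α β : ℕ → ℝ} (hα : ∀ k, 0 < α k) (hα_anti : Antitone α)
    (hα0 : Tendsto α atTop (nhds 0)) (hβα : Summable fun k => β k ^ 2 / α k)
    {e η : ℕ → Ω → ι → E} (he : ∀ k i, Measurable[𝓕 k] fun ω => e k ω i)
    (he_bdd : ∀ k i, ∃ M, ∀ ω, ‖e k ω i‖ ≤ M) (he0 : ∀ k ω, ∑ i, e k ω i = 0)
    {c : ℝ} (hη : ∀ k ω i, ‖η k ω i‖ ≤ c)
    (hstep : ∀ k ω i, e (k + 1) ω i =
      e k ω i + α k • consensusDrift (A (θ k ω)) (e k ω) i - β k • η k ω i) :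
    ∀ᵐ ω ∂μ, Summable fun k => α k * ∑ i, ‖e k ω i‖ ^ 2 := by
  obtain ⟨w, K, hK, hw, hPw⟩ := exists_foster_function hP_nonneg hP_row hP_irr
  obtain ⟨C, hC, hV⟩ := exists_sum_norm_sq_le_sum_disagreement (E := E) hA hconn
  obtain ⟨r, a₀, B, hr, ha₀, hB, hlyap⟩ :=
    exists_lyapunov_step (E := E) hA hrow hcol hK hw hPw hC c
  obtain ⟨k₀, hk₀⟩ := eventually_atTop.1 (hα0.eventually (gt_mem_nhds ha₀))
  choose M hM using he_bdd
  have hVint : ∀ k, Integrable (fun ω => ∑ i, ‖e k ω i‖ ^ 2) μ := fun k => by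
    refine Integrable.of_bound ((measurable_sum_norm_sq (he k)).mono (𝓕.le k)
      le_rfl).aestronglyMeasurable (∑ i, M k i ^ 2) (ae_of_all _ fun ω => ?_)
    rw [Real.norm_of_nonneg (Finset.sum_nonneg fun i _ => sq_nonneg _)]
    gcongr with i
    exact hM k i ω
  have hQm : ∀ k j, Measurable[𝓕 k] fun ω => disagreement (A j) (e k ω) := fun k j =>
    measurable_disagreement (A j) (he k)
  have hQint : ∀ k j, Integrable (fun ω => disagreement (A j) (e k ω)) μ := fun k j => by
    refine ((hVint k).const_mul 2).mono ((hQm k j).mono (𝓕.le k) le_rfl).aestronglyMeasurable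
      (ae_of_all _ fun ω => ?_)
    rw [Real.norm_of_nonneg (disagreement_nonneg (hA j) _)]
    exact (disagreement_le (hA j) (hrow j) (hcol j) _).trans (le_abs_self _)
  have hGint : ∀ k k', Integrable
      (fun ω => ∑ j, w j (θ k' ω) * disagreement (A j) (e k ω)) μ := fun k k' =>
    integrable_finsetSum _ fun j _ => integrable_comp_mul (w j) (hθ k') (hQint k j)
  have hPGint : ∀ k j, Integrable
      (fun ω => (∑ u, P (θ k ω) u * w j u) * disagreement (A j) (e k ω)) μ := fun k j =>
    integrable_comp_mul (fun s => ∑ u, P s u * w j u) (hθ k) (hQint k j)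
  set L : ℕ → Ω → ℝ := fun k ω => K * ∑ i, ‖e k ω i‖ ^ 2 +
    α k * ∑ j, w j (θ k ω) * disagreement (A j) (e k ω) with hL
  have hLint : ∀ k, Integrable (L k) μ := fun k =>
    ((hVint k).const_mul K).add ((hGint k k).const_mul (α k))
  have hmart : ∀ k, ∫ ω, (∑ j, w j (θ (k + 1) ω) * disagreement (A j) (e k ω) -
      ∑ j, (∑ u, P (θ k ω) u * w j u) * disagreement (A j) (e k ω)) ∂μ = 0 := by
    intro k
    rw [integral_sub (hGint k (k + 1)) (integrable_finsetSum _ fun j _ => hPGint k j),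
      integral_finsetSum _ fun j _ => integrable_comp_mul (w j) (hθ (k + 1)) (hQint k j),
      integral_finsetSum _ fun j _ => hPGint k j, sub_eq_zero]
    exact Finset.sum_congr rfl fun j _ => integral_comp_mul_of_markov (𝓕.le k) (hθ k)
      (hθ (k + 1)) (hmarkov k) (w j) (hQm k j) (hQint k j)
  have hdec : ∀ k, k₀ ≤ k → ∫ ω, L (k + 1) ω ∂μ ≤
      ∫ ω, L k ω ∂μ - r * ∫ ω, α k * ∑ i, ‖e k ω i‖ ^ 2 ∂μ + B * (β k ^ 2 / α k) := by
    intro k hk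
    have hint1 : Integrable (fun ω =>
        α k * (∑ j, w j (θ (k + 1) ω) * disagreement (A j) (e k ω) -
          ∑ j, (∑ u, P (θ k ω) u * w j u) * disagreement (A j) (e k ω))) μ :=
      ((hGint k (k + 1)).sub (integrable_finsetSum _ fun j _ => hPGint k j)).const_mul _
    have hint2 : Integrable (fun ω => r * (α k * ∑ i, ‖e k ω i‖ ^ 2)) μ :=
      ((hVint k).const_mul _).const_mul _
    have hint3 := ((hLint k).add hint1).sub hint2
    have hmono := integral_mono (hLint (k + 1))
      (hint3.add (integrable_const (B * (β k ^ 2 / α k)))) fun ω =>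
        hlyap (e k ω) (e (k + 1) ω) (η k ω) (θ k ω) (θ (k + 1) ω) (α k) (α (k + 1)) (β k) (hα k)
          (hk₀ k hk).le (hα_anti (Nat.le_succ k)) (hη k ω) (hV _ (he0 k ω)) (hstep k ω)
    rw [integral_add' hint3 (integrable_const _), integral_sub' ((hLint k).add hint1) hint2,
      integral_add' (hLint k) hint1, integral_const_mul (α k), hmart, integral_const_mul r,
      integral_const] at hmono
    simpa using hmono
  have hV0 : ∀ k ω, 0 ≤ α k * ∑ i, ‖e k ω i‖ ^ 2 := fun k ω =>
    mul_nonneg (hα k).le (Finset.sum_nonneg fun i _ => sq_nonneg _)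
  have hs := (summable_and_tendsto_of_le_sub_add (u := fun k => ∫ ω, L k ω ∂μ)
    (fun k => integral_nonneg fun ω => add_nonneg
      (mul_nonneg hK (Finset.sum_nonneg fun i _ => sq_nonneg _))
      (mul_nonneg (hα k).le (Finset.sum_nonneg fun j _ =>
        mul_nonneg (hw j _) (disagreement_nonneg (hA j) _))))
    (fun k => mul_nonneg hr.le (integral_nonneg (hV0 k)))
    (fun k => mul_nonneg hB (div_nonneg (sq_nonneg _) (hα k).le)) (hβα.mul_left B) hdec).1
  exact ae_summable_of_summable_integral hV0 (fun k => (hVint k).const_mul _)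
    ((summable_mul_left_iff hr.ne').1 hs)

end Consensus

section Average

variable {ι E : Type*} [Fintype ι] [NormedAddCommGroup E] [InnerProductSpace ℝ E]

/-- The arithmetic mean of a configuration. -/
noncomputable def configMean (x : ι → E) : E :=
  (Fintype.card ι : ℝ)⁻¹ • ∑ i, x i

theorem card_smul_configMean [Nonempty ι] (x : ι → E) :
    (Fintype.card ι : ℝ) • configMean x = ∑ i, x i :=
  smul_inv_smul₀ (Nat.cast_ne_zero.2 Fintype.card_ne_zero) _

theorem sum_sub_configMean [Nonempty ι] (x : ι → E) : ∑ i, (x i - configMean x) = 0 := by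
  rw [Finset.sum_sub_distrib, Finset.sum_const, Finset.card_univ, ← Nat.cast_smul_eq_nsmul ℝ,
    card_smul_configMean, sub_self]

theorem norm_configMean_le [Nonempty ι] {x : ι → E} {c : ℝ} (hx : ∀ i, ‖x i‖ ≤ c) :
    ‖configMean x‖ ≤ c := by
  have hN : (0 : ℝ) < Fintype.card ι := Nat.cast_pos.2 Fintype.card_pos
  rw [configMean, norm_smul, norm_inv, Real.norm_of_nonneg hN.le, inv_mul_le_iff₀ hN]
  calc ‖∑ i, x i‖ ≤ ∑ _i : ι, c := norm_sum_le_of_le _ fun i _ => hx i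
    _ = _ := by simp

theorem consensusDrift_sub_const (A : Matrix ι ι ℝ) (x : ι → E) (v : E) :
    consensusDrift A (fun i => x i - v) = consensusDrift A x := by
  funext i
  simp [consensusDrift]

theorem configMean_consensusDrift {A : Matrix ι ι ℝ} (hrow : ∀ i, ∑ j, A i j = 1)
    (hcol : ∀ j, ∑ i, A i j = 1) (x : ι → E) : configMean (consensusDrift A x) = 0 := by
  simp only [configMean, consensusDrift, smul_sub, Finset.sum_sub_distrib]
  rw [Finset.sum_comm]
  simp only [← Finset.sum_smul, hrow, hcol, sub_self]

theorem configMean_step {A : Matrix ι ι ℝ} (hrow : ∀ i, ∑ j, A i j = 1)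
    (hcol : ∀ j, ∑ i, A i j = 1) {x x' d : ι → E} {α β : ℝ}
    (h : ∀ i, x' i = x i + α • consensusDrift A x i - β • d i) :
    configMean x' = configMean x - β • configMean d := by
  have h0 := configMean_consensusDrift hrow hcol x
  have h1 : configMean x' =
      configMean x + α • configMean (consensusDrift A x) - β • configMean d := by
    simp only [configMean, h, Finset.sum_sub_distrib, Finset.sum_add_distrib, ← Finset.smul_sum,
      smul_sub, smul_add, smul_comm _ (Fintype.card ι : ℝ)⁻¹]
  rw [h1, h0, smul_zero, add_zero]

theorem sub_configMean_step {A : Matrix ι ι ℝ} (hrow : ∀ i, ∑ j, A i j = 1)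
    (hcol : ∀ j, ∑ i, A i j = 1) {x x' d : ι → E} {α β : ℝ}
    (h : ∀ i, x' i = x i + α • consensusDrift A x i - β • d i) (i : ι) :
    x' i - configMean x' = (x i - configMean x) +
      α • consensusDrift A (fun i => x i - configMean x) i - β • (d i - configMean d) := by
  rw [configMean_step hrow hcol h, h i, consensusDrift_sub_const, smul_sub]
  abel

end Average

section Subgradient

variable {n : ℕ}

theorem sub_le_of_subdiff {f : EuclideanSpace ℝ (Fin n) → ℝ} {l : ℝ}
    (hne : ∀ w, (subdiff f w).Nonempty) (hbd : ∀ w g, g ∈ subdiff f w → ‖g‖ ≤ l)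
    (y z : EuclideanSpace ℝ (Fin n)) : f y - f z ≤ l * ‖y - z‖ := by
  obtain ⟨g, hg⟩ := hne y
  have h1 := hg z
  have h2 : -⟪g, z - y⟫ ≤ ‖g‖ * ‖z - y‖ := (neg_le_abs _).trans (abs_real_inner_le_norm _ _)
  have h3 := mul_le_mul_of_nonneg_right (hbd y g hg) (norm_nonneg (z - y))
  rw [norm_sub_rev y]
  linarith

theorem continuous_of_subdiff {f : EuclideanSpace ℝ (Fin n) → ℝ} {l : ℝ}
    (hne : ∀ w, (subdiff f w).Nonempty) (hbd : ∀ w g, g ∈ subdiff f w → ‖g‖ ≤ l) :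
    Continuous f := by
  refine (LipschitzWith.of_dist_le_mul (K := l.toNNReal) fun y z => ?_).continuous
  rw [Real.dist_eq, dist_eq_norm, abs_le]
  have h1 := sub_le_of_subdiff hne hbd y z
  have h2 := sub_le_of_subdiff hne hbd z y
  have h3 := mul_le_mul_of_nonneg_right (Real.le_coe_toNNReal l) (norm_nonneg (y - z))
  rw [norm_sub_rev] at h2
  constructor <;> linarith

/-- A subgradient step of the mean with subgradients taken at nearby points. -/
theorem norm_sq_configMean_step_le {ι : Type*} [Fintype ι] [Nonempty ι]
    {f : ι → EuclideanSpace ℝ (Fin n) → ℝ} {l : ℝ}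
    (hne : ∀ i w, (subdiff (f i) w).Nonempty) (hbd : ∀ i w g, g ∈ subdiff (f i) w → ‖g‖ ≤ l)
    {x d : ι → EuclideanSpace ℝ (Fin n)} (hd : ∀ i, d i ∈ subdiff (f i) (x i))
    {β : ℝ} (hβ : 0 ≤ β) (z y : EuclideanSpace ℝ (Fin n)) :
    ‖z - β • configMean d - y‖ ^ 2 ≤ ‖z - y‖ ^ 2 -
      2 / Fintype.card ι * β * (∑ i, f i z - ∑ i, f i y) +
      (4 * l / Fintype.card ι * (β * ∑ i, ‖x i - z‖) + l ^ 2 * β ^ 2) := by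
  have hN : (0 : ℝ) < Fintype.card ι := Nat.cast_pos.2 Fintype.card_pos
  have h1 : ∀ i, f i z - f i y - 2 * l * ‖x i - z‖ ≤ ⟪z - y, d i⟫ := by
    intro i
    have ha := hd i y
    have hb := sub_le_of_subdiff (hne i) (hbd i) z (x i)
    have hc : -⟪d i, z - x i⟫ ≤ ‖d i‖ * ‖z - x i‖ :=
      (neg_le_abs _).trans (abs_real_inner_le_norm _ _)
    have hd' := mul_le_mul_of_nonneg_right (hbd i _ _ (hd i)) (norm_nonneg (z - x i))
    have he : ⟪z - y, d i⟫ = ⟪d i, z - x i⟫ - ⟪d i, y - x i⟫ := by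
      rw [real_inner_comm, ← inner_sub_right, sub_sub_sub_cancel_right]
    rw [norm_sub_rev z] at hb hc hd'
    linarith
  have h2 : (∑ i, f i z - ∑ i, f i y) - 2 * l * ∑ i, ‖x i - z‖ ≤
      Fintype.card ι * ⟪z - y, configMean d⟫ := by
    rw [← inner_smul_right, card_smul_configMean, inner_sum, Finset.mul_sum,
      ← Finset.sum_sub_distrib, ← Finset.sum_sub_distrib]
    exact Finset.sum_le_sum fun i _ => h1 i
  have h3 : ‖configMean d‖ ^ 2 ≤ l ^ 2 := by
    gcongr
    exact norm_configMean_le fun i => hbd i _ _ (hd i)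
  have h4 : ‖z - β • configMean d - y‖ ^ 2 =
      ‖z - y‖ ^ 2 - 2 * β * ⟪z - y, configMean d⟫ + β ^ 2 * ‖configMean d‖ ^ 2 := by
    rw [sub_right_comm, norm_sub_sq_real, inner_smul_right, norm_smul, mul_pow,
      Real.norm_eq_abs, sq_abs]
    ring
  have h5 := mul_le_mul_of_nonneg_left h2 (by positivity : 0 ≤ 2 / Fintype.card ι * β)
  have h6 : 2 / Fintype.card ι * β * (Fintype.card ι * ⟪z - y, configMean d⟫) =
      2 * β * ⟪z - y, configMean d⟫ := by
    field_simp
  have h7 := mul_le_mul_of_nonneg_left h3 (sq_nonneg β)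
  have h8 : 2 / Fintype.card ι * β *
      ((∑ i, f i z - ∑ i, f i y) - 2 * l * ∑ i, ‖x i - z‖) =
      2 / Fintype.card ι * β * (∑ i, f i z - ∑ i, f i y) -
        4 * l / Fintype.card ι * (β * ∑ i, ‖x i - z‖) := by ring
  rw [h4]
  linarith

/-- Pathwise convergence of the consensus subgradient method once the squared deviations are
summable against the consensus step sizes. -/
theorem exists_common_limit_of_summable {ι κ : Type*} [Fintype ι] [Nonempty ι]
    {f : ι → EuclideanSpace ℝ (Fin n) → ℝ} {l : ℝ} (hl : 0 ≤ l)
    (hne : ∀ i w, (subdiff (f i) w).Nonempty) (hbd : ∀ i w g, g ∈ subdiff (f i) w → ‖g‖ ≤ l)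
    (hmin : ∃ y, ∀ z, (∑ i, f i y) ≤ ∑ i, f i z)
    {A : κ → Matrix ι ι ℝ} (hA : ∀ l i j, 0 ≤ A l i j) (hrow : ∀ l i, ∑ j, A l i j = 1)
    (hcol : ∀ l j, ∑ i, A l i j = 1)
    {α β : ℕ → ℝ} (hα : ∀ k, 0 < α k) (hβ : ∀ k, 0 < β k)
    (hα0 : Tendsto α atTop (nhds 0)) (hαs : ¬Summable α) (hβs : ¬Summable β)
    (hβα : Summable fun k => β k ^ 2 / α k) {θ : ℕ → κ}
    {x d : ℕ → ι → EuclideanSpace ℝ (Fin n)} (hd : ∀ k i, d k i ∈ subdiff (f i) (x k i))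
    (hstep : ∀ k i, x (k + 1) i =
      x k i + α k • consensusDrift (A (θ k)) (x k) i - β k • d k i)
    (hV : Summable fun k => α k * ∑ i, ‖x k i - configMean (x k)‖ ^ 2) :
    ∃ y, (∀ z, (∑ i, f i y) ≤ ∑ i, f i z) ∧
      ∀ i, Tendsto (fun k => x k i) atTop (nhds y) := by
  have hN : (0 : ℝ) < Fintype.card ι := Nat.cast_pos.2 Fintype.card_pos
  obtain ⟨k₀, hk₀⟩ := eventually_atTop.1 (hα0.eventually (gt_mem_nhds one_half_pos))
  have hdl : ∀ k i, ‖d k i‖ ≤ l := fun k i => hbd i _ _ (hd k i)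
  have hη : ∀ k i, ‖d k i - configMean (d k)‖ ≤ 2 * l := fun k i => by
    linarith [norm_sub_le (d k i) (configMean (d k)), hdl k i, norm_configMean_le (hdl k)]
  have hV0 : ∀ k, 0 ≤ ∑ i, ‖x k i - configMean (x k)‖ ^ 2 := fun k =>
    Finset.sum_nonneg fun i _ => sq_nonneg _
  have hβα0 : ∀ k, 0 ≤ β k ^ 2 / α k := fun k => div_nonneg (sq_nonneg _) (hα k).le
  have hVlim : Tendsto (fun k => ∑ i, ‖x k i - configMean (x k)‖ ^ 2) atTop (nhds 0) := by
    have hrec : ∀ k, k₀ ≤ k → ∑ i, ‖x (k + 1) i - configMean (x (k + 1))‖ ^ 2 ≤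
        ∑ i, ‖x k i - configMean (x k)‖ ^ 2 - 0 +
          (α k * ∑ i, ‖x k i - configMean (x k)‖ ^ 2 +
            (1 + 1 / 1) * (Fintype.card ι * (2 * l) ^ 2) * (β k ^ 2 / α k)) := by
      intro k hk
      have h1 : ∀ i, x (k + 1) i - configMean (x (k + 1)) = x k i - configMean (x k) +
          α k • consensusDrift (A (θ k)) (fun i => x k i - configMean (x k)) i -
            β k • (d k i - configMean (d k)) :=
        sub_configMean_step (hrow (θ k)) (hcol (θ k)) (hstep k)
      have h2 := sum_norm_sq_step_le (hA (θ k)) (hrow (θ k)) (hcol (θ k)) (hα k) (hk₀ k hk).le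
        one_pos (hη k) (e := fun i => x k i - configMean (x k))
        (e' := fun i => x (k + 1) i - configMean (x (k + 1))) h1
      have h0 := mul_nonneg (hα k).le
        (disagreement_nonneg (hA (θ k)) fun i => x k i - configMean (x k))
      linarith
    obtain ⟨-, c, hc⟩ := summable_and_tendsto_of_le_sub_add (k₀ := k₀)
      (u := fun k => ∑ i, ‖x k i - configMean (x k)‖ ^ 2) hV0
      (a := fun _ => 0) (fun _ => le_rfl)
      (b := fun k => α k * ∑ i, ‖x k i - configMean (x k)‖ ^ 2 +
        (1 + 1 / 1) * (Fintype.card ι * (2 * l) ^ 2) * (β k ^ 2 / α k))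
      (fun k => add_nonneg (mul_nonneg (hα k).le (hV0 k)) (mul_nonneg (by positivity) (hβα0 k)))
      (hV.add (hβα.mul_left ((1 + 1 / 1) * (Fintype.card ι * (2 * l) ^ 2)))) hrec
    exact tendsto_zero_of_summable_mul (fun k => (hα k).le) hαs hV0 hV hc
  have hdev : ∀ i, Tendsto (fun k => x k i - configMean (x k)) atTop (nhds 0) := by
    intro i
    have h1 : Tendsto (fun k => ‖x k i - configMean (x k)‖ ^ 2) atTop (nhds 0) :=
      squeeze_zero (fun k => sq_nonneg _) (fun k => Finset.single_le_sum
        (f := fun i => ‖x k i - configMean (x k)‖ ^ 2) (fun i _ => sq_nonneg _)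
        (Finset.mem_univ i)) hVlim
    rw [tendsto_zero_iff_norm_tendsto_zero]
    simpa using h1.sqrt
  have hβV : Summable fun k => β k * ∑ i, ‖x k i - configMean (x k)‖ := by
    refine Summable.of_nonneg_of_le
      (fun k => mul_nonneg (hβ k).le (Finset.sum_nonneg fun i _ => norm_nonneg _)) (fun k => ?_)
      (hV.add (hβα.mul_left (Fintype.card ι : ℝ)))
    have h1 : ∀ i, β k * ‖x k i - configMean (x k)‖ ≤
        α k * ‖x k i - configMean (x k)‖ ^ 2 + β k ^ 2 / α k := by
      intro i
      set v := ‖x k i - configMean (x k)‖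
      have ha := hα k
      have h2 : 0 ≤ ((α k * v - β k) ^ 2 + 2 * (α k * (v * β k)) - α k * (v * β k)) / α k := by
        refine div_nonneg ?_ ha.le
        have : 0 ≤ α k * (v * β k) := mul_nonneg ha.le (mul_nonneg (norm_nonneg _) (hβ k).le)
        nlinarith [sq_nonneg (α k * v - β k)]
      have h3 : ((α k * v - β k) ^ 2 + 2 * (α k * (v * β k)) - α k * (v * β k)) / α k =
          α k * v ^ 2 + β k ^ 2 / α k - β k * v := by
        field_simp
        ring
      linarith
    calc β k * ∑ i, ‖x k i - configMean (x k)‖ = ∑ i, β k * ‖x k i - configMean (x k)‖ :=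
          Finset.mul_sum _ _ _
      _ ≤ ∑ i, (α k * ‖x k i - configMean (x k)‖ ^ 2 + β k ^ 2 / α k) :=
          Finset.sum_le_sum fun i _ => h1 i
      _ = _ := by simp [Finset.sum_add_distrib, Finset.mul_sum]
  have hβ2 : Summable fun k => β k ^ 2 := by
    refine Summable.of_norm_bounded_eventually_nat hβα ?_
    filter_upwards [eventually_ge_atTop k₀] with k hk
    rw [Real.norm_of_nonneg (sq_nonneg _), le_div_iff₀ (hα k)]
    nlinarith [sq_nonneg (β k), hk₀ k hk]
  obtain ⟨y, hy, hlim⟩ := exists_tendsto_minimizer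
    (F := fun z => ∑ i, f i z) (z := fun k => configMean (x k))
    (β := fun k => 2 / Fintype.card ι * β k)
    (b := fun k => 4 * l / Fintype.card ι * (β k * ∑ i, ‖x k i - configMean (x k)‖) +
      l ^ 2 * β k ^ 2) (k₀ := 0)
    (continuous_finsetSum _ fun i _ => continuous_of_subdiff (hne i) (hbd i)) hmin
    (fun k => mul_nonneg (by positivity) (hβ k).le)
    (fun h => hβs ((summable_mul_left_iff (by positivity)).1 h))
    (fun k => add_nonneg (mul_nonneg (by positivity)
      (mul_nonneg (hβ k).le (Finset.sum_nonneg fun i _ => norm_nonneg _))) (by positivity))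
    ((hβV.mul_left _).add (hβ2.mul_left _))
    fun y _ k _ => by
      rw [configMean_step (hrow (θ k)) (hcol (θ k)) (hstep k)]
      exact norm_sq_configMean_step_le hne hbd (hd k) (hβ k).le _ y
  refine ⟨y, hy, fun i => ?_⟩
  simpa using (hdev i).add hlim

end Subgradient

section StepSize

theorem antitone_div_rpow {a δ : ℝ} (ha : 0 < a) (hδ : 0 < δ) :
    Antitone fun k : ℕ => a / ((k : ℝ) + 1) ^ δ := by
  intro i j hij
  dsimp only
  gcongr

theorem tendsto_div_rpow_zero (a : ℝ) {δ : ℝ} (hδ : 0 < δ) :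
    Tendsto (fun k : ℕ => a / ((k : ℝ) + 1) ^ δ) atTop (nhds 0) :=
  tendsto_const_nhds.div_atTop <| (tendsto_rpow_atTop hδ).comp <|
    tendsto_atTop_add_const_right _ _ tendsto_natCast_atTop_atTop

theorem summable_div_rpow_iff {a : ℝ} (ha : 0 < a) (δ : ℝ) :
    (Summable fun k : ℕ => a / ((k : ℝ) + 1) ^ δ) ↔ 1 < δ := by
  rw [← Real.summable_one_div_nat_add_rpow 1 δ,
    ← summable_mul_left_iff (f := fun k : ℕ => 1 / |(k : ℝ) + 1| ^ δ) ha.ne']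
  refine summable_congr fun k => ?_
  rw [abs_of_pos (by positivity), mul_one_div]

end StepSize

/-- **Almost sure convergence to a consensual optimal solution.** Under the
Markovian switching network model, the consensus subgradient algorithm, and the step-size
assumptions, with probability 1 there exists an optimal point `x* ∈ argmin Σ_i f_i` such that
every agent's state converges to `x*`. -/
theorem stmt2 {Ω : Type*} {m0 : MeasurableSpace Ω} (ℙ : Measure Ω)
    [IsProbabilityMeasure ℙ] (𝓕 : Filtration ℕ m0)
    -- the Markovian switching communication network
    (m : ℕ) (hm : 1 ≤ m)
    (P : Matrix (Fin m) (Fin m) ℝ)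
    (hP_nonneg : ∀ i j, 0 ≤ P i j)
    (hP_row : ∀ i, ∑ j, P i j = 1)
    (hP_irr : ∀ i j, ∃ q : ℕ, 1 ≤ q ∧ 0 < (P ^ q) i j)
    (θ : ℕ → Ω → Fin m)
    (hθ_adapt : ∀ k, Measurable[𝓕 k] (θ k))
    (hθ_markov : ∀ k (j : Fin m),
      ℙ[Set.indicator {ω | θ (k + 1) ω = j} (fun _ => (1 : ℝ))|𝓕 k]
        =ᵐ[ℙ] fun ω => P (θ k ω) j)
    (N : ℕ) (hN : 2 ≤ N)
    (A : Fin m → Matrix (Fin N) (Fin N) ℝ)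
    (hA_nonneg : ∀ l i j, 0 ≤ A l i j)
    (hA_row : ∀ l i, ∑ j, A l i j = 1)
    (hA_col : ∀ l j, ∑ i, A l i j = 1)
    (hconn : ∀ i j : Fin N,
      Relation.ReflTransGen (fun u v : Fin N => ∃ l, 0 < A l v u) i j)
    -- the two time-scale step sizes
    (a₁ a₂ δ₁ δ₂ : ℝ) (ha₁ : 0 < a₁) (ha₂ : 0 < a₂)
    (hδ₁0 : 0 < δ₁) (hδ₁₂ : δ₁ < δ₂) (hδ₂1 : δ₂ ≤ 1) (hgap : 1 / 2 ≤ δ₂ - δ₁)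
    (α β : ℕ → ℝ)
    (hα : ∀ k : ℕ, α k = a₁ / ((k : ℝ) + 1) ^ δ₁)
    (hβ : ∀ k : ℕ, β k = a₂ / ((k : ℝ) + 1) ^ δ₂)
    -- the local objective functions
    (n : ℕ) (hn : 1 ≤ n) (l : ℝ) (hl : 0 < l)
    (f : Fin N → EuclideanSpace ℝ (Fin n) → ℝ)
    (hconv : ∀ i, ConvexOn ℝ Set.univ (f i))
    (hsub_ne : ∀ i w, (subdiff (f i) w).Nonempty)
    (hsub_bd : ∀ i w g, g ∈ subdiff (f i) w → ‖g‖ ≤ l)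
    (hsolvable : ∃ xs : EuclideanSpace ℝ (Fin n), ∀ z, (∑ i, f i xs) ≤ ∑ i, f i z)
    -- the consensus subgradient algorithm
    (x : Fin N → ℕ → Ω → EuclideanSpace ℝ (Fin n))
    (hx0 : ∀ i, ∃ c, ∀ ω, x i 0 ω = c)
    (d : Fin N → ℕ → Ω → EuclideanSpace ℝ (Fin n))
    (hd_meas : ∀ i k, Measurable[𝓕 k] (d i k))
    (hd_sub : ∀ i k ω, d i k ω ∈ subdiff (f i) (x i k ω))
    (hupdate : ∀ i k ω,
      x i (k + 1) ω = x i k ω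
        + α k • (∑ j, A (θ k ω) i j • (x j k ω - x i k ω))
        - β k • d i k ω) :
    ∀ᵐ ω ∂ℙ, ∃ xstar : EuclideanSpace ℝ (Fin n),
      (∀ z, (∑ i, f i xstar) ≤ ∑ i, f i z) ∧
        ∀ i : Fin N, Tendsto (fun k => x i k ω) atTop (nhds xstar) := by
  have : NeZero N := ⟨by omega⟩
  have hα_pos : ∀ k, 0 < α k := fun k => by rw [hα]; positivity
  have hβ_pos : ∀ k, 0 < β k := fun k => by rw [hβ]; positivity
  have hα0 : Tendsto α atTop (nhds 0) := by
    rw [funext hα]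
    exact tendsto_div_rpow_zero a₁ hδ₁0
  have hα_anti : Antitone α := by
    rw [funext hα]
    exact antitone_div_rpow ha₁ hδ₁0
  have hαs : ¬Summable α := by
    rw [funext hα, summable_div_rpow_iff ha₁]
    linarith
  have hβs : ¬Summable β := by
    rw [funext hβ, summable_div_rpow_iff ha₂]
    linarith
  have hβα : Summable fun k => β k ^ 2 / α k := by
    have h : ∀ k : ℕ, β k ^ 2 / α k = (a₂ ^ 2 / a₁) / ((k : ℝ) + 1) ^ (2 * δ₂ - δ₁) := by
      intro k
      have hk : (0 : ℝ) < (k : ℝ) + 1 := by positivity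
      rw [hα, hβ, Real.rpow_sub hk, two_mul, Real.rpow_add hk]
      field_simp
    rw [funext h, summable_div_rpow_iff (by positivity)]
    linarith
  have hd_bd : ∀ i k ω, ‖d i k ω‖ ≤ l := fun i k ω => hsub_bd i _ _ (hd_sub i k ω)
  have hx_meas : ∀ k i, Measurable[𝓕 k] (x i k) := by
    intro k
    induction k with
    | zero =>
      intro i
      obtain ⟨c, hc⟩ := hx0 i
      rw [funext hc]
      exact measurable_const
    | succ k ih =>
      intro i
      rw [funext (hupdate i k)]
      refine Measurable.mono (?_ : Measurable[𝓕 k] _) (𝓕.mono (Nat.le_succ k)) le_rfl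
      have h1 : ∀ j, Measurable[𝓕 k] fun ω => A (θ k ω) i j :=
        fun j => (Measurable.of_discrete (f := fun s => A s i j)).comp (hθ_adapt k)
      have h2 : Measurable[𝓕 k] fun ω => ∑ j, A (θ k ω) i j • (x j k ω - x i k ω) :=
        Finset.measurable_fun_sum _ fun j _ => (h1 j).smul ((ih j).sub (ih i))
      exact ((ih i).add (h2.const_smul (α k))).sub ((hd_meas i k).const_smul (β k))
  have hmean_meas : ∀ k, Measurable[𝓕 k] fun ω => configMean fun i => x i k ω := fun k =>
    (Finset.measurable_fun_sum Finset.univ fun j _ => hx_meas k j).const_smul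
      (Fintype.card (Fin N) : ℝ)⁻¹
  have hx_bdd : ∀ k i, ∃ M, ∀ ω, ‖x i k ω‖ ≤ M := by
    intro k
    induction k with
    | zero =>
      intro i
      obtain ⟨c, hc⟩ := hx0 i
      exact ⟨‖c‖, fun ω => by rw [hc]⟩
    | succ k ih =>
      intro i
      choose M hM using ih
      refine ⟨M i + α k * ∑ j, (∑ s, A s i j) * (M j + M i) + β k * l, fun ω => ?_⟩
      rw [hupdate]
      refine (norm_sub_le _ _).trans (add_le_add ((norm_add_le _ _).trans
        (add_le_add (hM i ω) ?_)) ?_)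
      · rw [norm_smul, Real.norm_of_nonneg (hα_pos k).le]
        refine mul_le_mul_of_nonneg_left (norm_sum_le_of_le _ fun j _ => ?_) (hα_pos k).le
        rw [norm_smul, Real.norm_of_nonneg (hA_nonneg _ _ _)]
        exact mul_le_mul
          (Finset.single_le_sum (f := fun s => A s i j) (fun s _ => hA_nonneg s i j)
            (Finset.mem_univ _))
          ((norm_sub_le _ _).trans (add_le_add (hM j ω) (hM i ω))) (norm_nonneg _)
          (Finset.sum_nonneg fun s _ => hA_nonneg s i j)
      · rw [norm_smul, Real.norm_of_nonneg (hβ_pos k).le]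
        exact mul_le_mul_of_nonneg_left (hd_bd i k ω) (hβ_pos k).le
  have hstep : ∀ k ω i, x i (k + 1) ω = x i k ω +
      α k • consensusDrift (A (θ k ω)) (fun i => x i k ω) i - β k • d i k ω :=
    fun k ω i => hupdate i k ω
  have hsum := ae_summable_sum_norm_sq (μ := ℙ) (𝓕 := 𝓕) hP_nonneg hP_row hP_irr
    (fun k => (hθ_adapt k).mono (𝓕.le k) le_rfl) hθ_markov hA_nonneg hA_row hA_col hconn
    hα_pos hα_anti hα0 hβα
    (e := fun k ω i => x i k ω - configMean fun i => x i k ω)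
    (η := fun k ω i => d i k ω - configMean fun i => d i k ω) (c := 2 * l)
    (fun k i => (hx_meas k i).sub (hmean_meas k))
    (fun k i => by
      choose M hM using hx_bdd k
      refine ⟨M i + ∑ j, M j, fun ω => (norm_sub_le _ _).trans (add_le_add (hM i ω)
        (norm_configMean_le fun j => (hM j ω).trans ?_))⟩
      exact Finset.single_le_sum (f := M) (fun j _ => (norm_nonneg _).trans (hM j ω))
        (Finset.mem_univ j))
    (fun k ω => sum_sub_configMean _)
    (fun k ω i => by
      linarith [norm_sub_le (d i k ω) (configMean fun i => d i k ω), hd_bd i k ω,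
        norm_configMean_le fun i => hd_bd i k ω])
    (fun k ω i => sub_configMean_step (hA_row _) (hA_col _) (hstep k ω) i)
  filter_upwards [hsum] with ω hω
  exact exists_common_limit_of_summable hl.le hsub_ne hsub_bd hsolvable hA_nonneg hA_row hA_col
    hα_pos hβ_pos hα0 hαs hβs hβα (θ := fun k => θ k ω) (x := fun k i => x i k ω)
    (d := fun k i => d i k ω) (fun k i => hd_sub i k ω) (fun k i => hstep k ω i) hω
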